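/- arXiv:1209.1849 — 3 statements merged into one kernel-verified Lean document; each statement's English description precedes it below -/
import Mathlib

section
/- Let n ≥ 1, let φ ∈ 𝒮(ℝ^n) be a window (‖φ‖_{L²} = 1), and let u ∈ 𝒮(ℝ^n). Then the inversion formula holds pointwise: for every x ∈ ℝ^n, u(x) = (2/π)^{n/2} ∫_{ℝ^{2n}} W_φ u(z₀) · e^{2iξ₀·(x−x₀)} φ(2x₀ − x) dz₀, where z₀ = (x₀, ξ₀) and e^{2iξ₀·(x−x₀)} φ(2x₀−x) = T_GR(z₀)φ(x) is the Grossmann–Royer operator applied to φ. -/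
open MeasureTheory Matrix ComplexConjugate

/-- The cross-Wigner transform
`W(u,v)(x,ξ) = (2π)^{-n} ∫ e^{-iξ·y} u(x + y/2) conj(v(x − y/2)) dy`. -/
noncomputable def crossWigner {n : ℕ} (u v : (Fin n → ℝ) → ℂ)
    (z : (Fin n → ℝ) × (Fin n → ℝ)) : ℂ :=
  ((((2 * Real.pi) ^ n : ℝ)⁻¹ : ℝ) : ℂ) *
    ∫ y : Fin n → ℝ, Complex.exp (-Complex.I * ((z.2 ⬝ᵥ y : ℝ) : ℂ)) *
      u (z.1 + (1/2 : ℝ) • y) * conj (v (z.1 - (1/2 : ℝ) • y))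

/-- The wave-packet transform `W_φ u = (2π)^{n/2} W(u,φ)`. -/
noncomputable def wavePacket {n : ℕ} (φ u : (Fin n → ℝ) → ℂ)
    (z : (Fin n → ℝ) × (Fin n → ℝ)) : ℂ :=
  ((Real.sqrt ((2 * Real.pi) ^ n) : ℝ) : ℂ) * crossWigner u φ z

open FourierTransform

section Fourier

variable {E : Type*} [NormedAddCommGroup E] [InnerProductSpace ℝ E] [FiniteDimensional ℝ E]
  [MeasurableSpace E] [BorelSpace E]

/-- A translation does not change the modulus of the inverse Fourier transform. -/
theorem SchwartzMap.norm_fourierInv_compSubConstCLM (a : SchwartzMap E ℂ) (s w : E) :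
    ‖𝓕⁻ (SchwartzMap.compSubConstCLM ℂ s a) w‖ = ‖𝓕⁻ a w‖ := by
  simp only [SchwartzMap.fourierInv_coe, Real.fourierInv_eq_fourier_neg]
  have h : ⇑(SchwartzMap.compSubConstCLM ℂ s a) = a ∘ fun v ↦ v + -s := by
    ext v
    simp [sub_eq_add_neg]
  rw [h]
  have := congrFun (VectorFourier.fourierIntegral_comp_add_right Real.fourierChar volume
    (innerₗ E) a (-s)) (-w)
  exact (congrArg norm this).trans (Circle.norm_smul _ _)

/-- The inverse Fourier transform turns products into convolutions. -/
theorem SchwartzMap.fourierInv_pairing_mul_apply (a b : SchwartzMap E ℂ) (w : E) :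
    𝓕⁻ (SchwartzMap.pairing (ContinuousLinearMap.mul ℂ ℂ) a b) w =
      ∫ r, 𝓕⁻ a r * 𝓕⁻ b (w - r) := by
  have h : 𝓕⁻ (SchwartzMap.pairing (ContinuousLinearMap.mul ℂ ℂ) a b) =
      SchwartzMap.convolution (ContinuousLinearMap.mul ℂ ℂ) (𝓕⁻ a) (𝓕⁻ b) := by
    simp [SchwartzMap.convolution]
  rw [h, SchwartzMap.convolution_apply, convolution_mul]

/-- The Fourier transforms of the products of translates of two Schwartz functions are dominated
by a single integrable function. -/
theorem SchwartzMap.exists_integrable_bound_fourier_mul_translates (a b : SchwartzMap E ℂ) :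
    ∃ g : E → ℝ, Integrable g ∧ ∀ s t w,
      ‖𝓕 (SchwartzMap.pairing (ContinuousLinearMap.mul ℂ ℂ)
        (SchwartzMap.compSubConstCLM ℂ s a) (SchwartzMap.compSubConstCLM ℂ t b)) w‖ ≤ g w := by
  refine ⟨fun w ↦ ∫ r, ‖𝓕⁻ a r‖ * ‖𝓕⁻ b (-w - r)‖, ?_, fun s t w ↦ ?_⟩
  · exact ((𝓕⁻ a).integrable.norm.integrable_convolution (ContinuousLinearMap.mul ℝ ℝ)
      (𝓕⁻ b).integrable.norm (μ := volume)).comp_neg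
  · have h := SchwartzMap.fourierInv_pairing_mul_apply (SchwartzMap.compSubConstCLM ℂ s a)
      (SchwartzMap.compSubConstCLM ℂ t b) (-w)
    rw [SchwartzMap.fourierInv_coe, Real.fourierInv_eq_fourier_neg, neg_neg,
      ← SchwartzMap.fourier_coe] at h
    rw [h]
    refine (norm_integral_le_integral_norm _).trans_eq ?_
    simp only [norm_mul, SchwartzMap.norm_fourierInv_compSubConstCLM]

end Fourier

section Pi

variable {n : ℕ}

/-- A Schwartz function on `Fin n → ℝ`, seen as a Schwartz function on Euclidean space. -/
noncomputable def SchwartzMap.toEuclidean (f : SchwartzMap (Fin n → ℝ) ℂ) :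
    SchwartzMap (EuclideanSpace ℝ (Fin n)) ℂ :=
  SchwartzMap.compCLMOfContinuousLinearEquiv ℂ
    (PiLp.continuousLinearEquiv 2 ℝ (fun _ : Fin n ↦ ℝ)) f

@[simp]
theorem SchwartzMap.toEuclidean_apply (f : SchwartzMap (Fin n → ℝ) ℂ)
    (y : EuclideanSpace ℝ (Fin n)) : f.toEuclidean y = f y.ofLp := rfl

theorem EuclideanSpace.integral_comp_ofLp (f : (Fin n → ℝ) → ℂ) :
    ∫ y : EuclideanSpace ℝ (Fin n), f y.ofLp = ∫ y, f y :=
  (PiLp.volume_preserving_ofLp (Fin n)).integral_comp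
    (MeasurableEquiv.toLp 2 (Fin n → ℝ)).symm.measurableEmbedding f

/-- The Fourier integral without `2π` in the phase is a rescaled Euclidean Fourier transform. -/
theorem SchwartzMap.integral_exp_mul_eq_fourier_toEuclidean (f : SchwartzMap (Fin n → ℝ) ℂ)
    (ξ : Fin n → ℝ) :
    ∫ y, Complex.exp (-Complex.I * ((ξ ⬝ᵥ y : ℝ) : ℂ)) * f y =
      𝓕 f.toEuclidean (WithLp.toLp 2 ((2 * Real.pi)⁻¹ • ξ)) := by
  rw [SchwartzMap.fourier_coe, Real.fourier_eq', ← EuclideanSpace.integral_comp_ofLp]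
  refine integral_congr_ae (.of_forall fun y ↦ ?_)
  have h : -2 * Real.pi * inner ℝ y (WithLp.toLp 2 ((2 * Real.pi)⁻¹ • ξ)) = -(ξ ⬝ᵥ y.ofLp) := by
    rw [EuclideanSpace.inner_eq_star_dotProduct, star_trivial, smul_dotProduct, smul_eq_mul]
    field_simp
  simp only [h, smul_eq_mul, SchwartzMap.toEuclidean_apply]
  congr 2
  push_cast
  ring

/-- Fourier inversion on `Fin n → ℝ`, without `2π` in the phase. -/
theorem SchwartzMap.integral_integral_exp_mul_exp (f : SchwartzMap (Fin n → ℝ) ℂ)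
    (v : Fin n → ℝ) :
    ∫ ξ : Fin n → ℝ, (∫ y, Complex.exp (-Complex.I * ((ξ ⬝ᵥ y : ℝ) : ℂ)) * f y) *
      Complex.exp (Complex.I * ((ξ ⬝ᵥ v : ℝ) : ℂ)) = (((2 * Real.pi) ^ n : ℝ) : ℂ) * f v := by
  set G : (Fin n → ℝ) → ℂ := fun η ↦ 𝓕 f.toEuclidean (WithLp.toLp 2 η) *
    Complex.exp (Complex.I * ((((2 * Real.pi) • η) ⬝ᵥ v : ℝ) : ℂ)) with hG
  have hpi : (2 * Real.pi) ≠ 0 := by positivity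
  have h : ∀ ξ : Fin n → ℝ, (∫ y, Complex.exp (-Complex.I * ((ξ ⬝ᵥ y : ℝ) : ℂ)) * f y) *
      Complex.exp (Complex.I * ((ξ ⬝ᵥ v : ℝ) : ℂ)) = G ((2 * Real.pi)⁻¹ • ξ) := by
    intro ξ
    simp only [hG, SchwartzMap.integral_exp_mul_eq_fourier_toEuclidean, smul_inv_smul₀ hpi]
  simp only [h]
  rw [Measure.integral_comp_inv_smul, Module.finrank_fin_fun, abs_of_pos (by positivity),
    Complex.real_smul, ← EuclideanSpace.integral_comp_ofLp]
  congr 1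
  have hinv : 𝓕⁻ (𝓕 f.toEuclidean) (WithLp.toLp 2 v) = f v := by simp
  rw [← hinv, SchwartzMap.fourierInv_coe, Real.fourierInv_eq']
  refine integral_congr_ae (.of_forall fun w ↦ ?_)
  simp only [hG, EuclideanSpace.inner_eq_star_dotProduct, star_trivial, smul_dotProduct,
    smul_eq_mul, dotProduct_comm v]
  rw [mul_comm, mul_comm Complex.I]

/-- The Fourier integrals of the products of translates of two Schwartz functions are dominated
by a single integrable function. -/
theorem SchwartzMap.exists_integrable_bound_integral_exp_mul (a b : SchwartzMap (Fin n → ℝ) ℂ) :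
    ∃ g : (Fin n → ℝ) → ℝ, Integrable g ∧ ∀ s t ξ,
      ‖∫ y, Complex.exp (-Complex.I * ((ξ ⬝ᵥ y : ℝ) : ℂ)) *
        SchwartzMap.pairing (ContinuousLinearMap.mul ℂ ℂ) (SchwartzMap.compSubConstCLM ℂ s a)
          (SchwartzMap.compSubConstCLM ℂ t b) y‖ ≤ g ξ := by
  obtain ⟨g, hg, hle⟩ :=
    SchwartzMap.exists_integrable_bound_fourier_mul_translates a.toEuclidean b.toEuclidean
  refine ⟨fun ξ ↦ g (WithLp.toLp 2 ((2 * Real.pi)⁻¹ • ξ)), ?_, fun s t ξ ↦ ?_⟩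
  · have := (PiLp.volume_preserving_toLp (Fin n)).integrable_comp_of_integrable hg
    exact this.comp_smul (R := (2 * Real.pi)⁻¹) (by positivity)
  · rw [SchwartzMap.integral_exp_mul_eq_fourier_toEuclidean]
    exact hle (WithLp.toLp 2 s) (WithLp.toLp 2 t) _

end Pi

section WavePacket

variable {n : ℕ}

/-- The map `y ↦ u (x + y / 2) * conj (v (x - y / 2))` as a Schwartz function. -/
noncomputable def wignerProduct (u v : SchwartzMap (Fin n → ℝ) ℂ) (x : Fin n → ℝ) :
    SchwartzMap (Fin n → ℝ) ℂ :=
  SchwartzMap.pairing (ContinuousLinearMap.mul ℂ ℂ)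
    (SchwartzMap.compSubConstCLM ℂ (-(2 : ℝ) • x) (SchwartzMap.compCLMOfContinuousLinearEquiv ℂ
      (ContinuousLinearEquiv.smulLeft (Units.mk0 (1 / 2 : ℝ) (by norm_num))) u))
    (SchwartzMap.compSubConstCLM ℂ ((2 : ℝ) • x) (SchwartzMap.compCLMOfContinuousLinearEquiv ℂ
      (ContinuousLinearEquiv.smulLeft (Units.mk0 (-1 / 2 : ℝ) (by norm_num)))
      (SchwartzMap.postcompCLM (Complex.conjCLE : ℂ →L[ℝ] ℂ) v)))

theorem wignerProduct_apply (u v : SchwartzMap (Fin n → ℝ) ℂ) (x y : Fin n → ℝ) :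
    wignerProduct u v x y = u (x + (1 / 2 : ℝ) • y) * conj (v (x - (1 / 2 : ℝ) • y)) := by
  have h₁ : (1 / 2 : ℝ) • (y - -(2 : ℝ) • x) = x + (1 / 2 : ℝ) • y := by module
  have h₂ : (-1 / 2 : ℝ) • (y - (2 : ℝ) • x) = x - (1 / 2 : ℝ) • y := by module
  rw [← h₁, ← h₂]
  rfl

theorem crossWigner_eq_integral_wignerProduct (u v : SchwartzMap (Fin n → ℝ) ℂ)
    (z : (Fin n → ℝ) × (Fin n → ℝ)) :
    crossWigner u v z = ((((2 * Real.pi) ^ n : ℝ)⁻¹ : ℝ) : ℂ) *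
      ∫ y, Complex.exp (-Complex.I * ((z.2 ⬝ᵥ y : ℝ) : ℂ)) * wignerProduct u v z.1 y := by
  simp only [crossWigner, wignerProduct_apply, mul_assoc]

theorem stronglyMeasurable_integral_exp_mul_wignerProduct (u v : SchwartzMap (Fin n → ℝ) ℂ) :
    StronglyMeasurable fun z : (Fin n → ℝ) × (Fin n → ℝ) ↦
      ∫ y, Complex.exp (-Complex.I * ((z.2 ⬝ᵥ y : ℝ) : ℂ)) * wignerProduct u v z.1 y := by
  refine StronglyMeasurable.integral_prod_right (Continuous.stronglyMeasurable ?_)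
  simp only [Function.uncurry_def, wignerProduct_apply, dotProduct]
  have hu := u.continuous
  have hv := v.continuous
  fun_prop

/-- The integrand of the inversion formula is jointly integrable. -/
theorem integrable_integral_exp_mul_wignerProduct_mul (u v : SchwartzMap (Fin n → ℝ) ℂ)
    (φ : SchwartzMap (Fin n → ℝ) ℂ) (x : Fin n → ℝ) :
    Integrable (fun z : (Fin n → ℝ) × (Fin n → ℝ) ↦
      (∫ y, Complex.exp (-Complex.I * ((z.2 ⬝ᵥ y : ℝ) : ℂ)) * wignerProduct u v z.1 y) *
        Complex.exp (Complex.I * ((z.2 ⬝ᵥ ((2 : ℝ) • (x - z.1)) : ℝ) : ℂ)) *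
        φ ((2 : ℝ) • z.1 - x)) (volume.prod volume) := by
  obtain ⟨g, hg, hle⟩ := SchwartzMap.exists_integrable_bound_integral_exp_mul
    (SchwartzMap.compCLMOfContinuousLinearEquiv ℂ
      (ContinuousLinearEquiv.smulLeft (Units.mk0 (1 / 2 : ℝ) (by norm_num))) u)
    (SchwartzMap.compCLMOfContinuousLinearEquiv ℂ
      (ContinuousLinearEquiv.smulLeft (Units.mk0 (-1 / 2 : ℝ) (by norm_num)))
      (SchwartzMap.postcompCLM (Complex.conjCLE : ℂ →L[ℝ] ℂ) v))
  have hφ : Integrable fun p : Fin n → ℝ ↦ ‖φ ((2 : ℝ) • p - x)‖ :=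
    ((φ.integrable (μ := volume)).comp_sub_right x).comp_smul (two_ne_zero' ℝ) |>.norm
  refine (hφ.mul_prod hg).mono' ?_ (.of_forall fun z ↦ ?_)
  · refine (((stronglyMeasurable_integral_exp_mul_wignerProduct u v).mul
      (Continuous.stronglyMeasurable ?_)).mul
      (Continuous.stronglyMeasurable ?_)).aestronglyMeasurable
    · simp only [dotProduct]
      fun_prop
    · have := φ.continuous
      fun_prop
  · rw [norm_mul, norm_mul, mul_comm Complex.I, Complex.norm_exp_ofReal_mul_I, mul_one, mul_comm]
    exact mul_le_mul_of_nonneg_left (hle _ _ _) (norm_nonneg _)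

end WavePacket

/-- the inversion formula for the wave-packet transform:
`u(x) = (2/π)^{n/2} ∫ W_φu(z₀) e^{2iξ₀·(x−x₀)} φ(2x₀ − x) dz₀`
(the Grossmann–Royer operator applied to `φ` appears in the integrand). -/
theorem stmt11 (n : ℕ) (hn : 1 ≤ n)
    (φ : SchwartzMap (Fin n → ℝ) ℂ)
    (hφ : ∫ x : Fin n → ℝ, ‖φ x‖ ^ 2 = 1)
    (u : SchwartzMap (Fin n → ℝ) ℂ) (x : Fin n → ℝ) :
    u x = ((Real.sqrt ((2 / Real.pi) ^ n) : ℝ) : ℂ) *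
        ∫ z₀ : (Fin n → ℝ) × (Fin n → ℝ),
          wavePacket (fun w => φ w) (fun w => u w) z₀ *
            Complex.exp (2 * Complex.I * ((z₀.2 ⬝ᵥ (x - z₀.1) : ℝ) : ℂ)) *
            φ ((2 : ℝ) • z₀.1 - x) := by
  set c : ℝ := √((2 * Real.pi) ^ n) * ((2 * Real.pi) ^ n)⁻¹ with hc
  have hintegrand : ∀ z₀ : (Fin n → ℝ) × (Fin n → ℝ),
      wavePacket (fun w => φ w) (fun w => u w) z₀ *
        Complex.exp (2 * Complex.I * ((z₀.2 ⬝ᵥ (x - z₀.1) : ℝ) : ℂ)) * φ ((2 : ℝ) • z₀.1 - x) =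
      (c : ℂ) * ((∫ y, Complex.exp (-Complex.I * ((z₀.2 ⬝ᵥ y : ℝ) : ℂ)) *
          wignerProduct u φ z₀.1 y) *
        Complex.exp (Complex.I * ((z₀.2 ⬝ᵥ ((2 : ℝ) • (x - z₀.1)) : ℝ) : ℂ)) *
        φ ((2 : ℝ) • z₀.1 - x)) := by
    intro z₀
    have hexp : 2 * Complex.I * ((z₀.2 ⬝ᵥ (x - z₀.1) : ℝ) : ℂ) =
        Complex.I * ((z₀.2 ⬝ᵥ ((2 : ℝ) • (x - z₀.1)) : ℝ) : ℂ) := by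
      rw [dotProduct_smul, smul_eq_mul]
      push_cast
      ring
    rw [hexp, wavePacket, crossWigner_eq_integral_wignerProduct, hc]
    push_cast
    ring
  have hslice : ∀ p : Fin n → ℝ,
      ∫ ξ : Fin n → ℝ, (∫ y, Complex.exp (-Complex.I * ((ξ ⬝ᵥ y : ℝ) : ℂ)) *
          wignerProduct u φ p y) *
        Complex.exp (Complex.I * ((ξ ⬝ᵥ ((2 : ℝ) • (x - p)) : ℝ) : ℂ)) * φ ((2 : ℝ) • p - x) =
      (((2 * Real.pi) ^ n : ℝ) : ℂ) * u x * ((‖φ ((2 : ℝ) • p - x)‖ ^ 2 : ℝ) : ℂ) := by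
    intro p
    have h₁ : p + (1 / 2 : ℝ) • ((2 : ℝ) • (x - p)) = x := by module
    have h₂ : p - (1 / 2 : ℝ) • ((2 : ℝ) • (x - p)) = (2 : ℝ) • p - x := by module
    rw [integral_mul_const, SchwartzMap.integral_integral_exp_mul_exp, wignerProduct_apply, h₁, h₂,
      Complex.ofReal_pow ‖_‖, ← Complex.conj_mul']
    ring
  have hnorm : ∫ p : Fin n → ℝ, ‖φ ((2 : ℝ) • p - x)‖ ^ 2 = ((2 : ℝ) ^ n)⁻¹ := by
    rw [Measure.integral_comp_smul volume (fun q ↦ ‖φ (q - x)‖ ^ 2),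
      integral_sub_right_eq_self (fun q ↦ ‖φ q‖ ^ 2), hφ, Module.finrank_fin_fun,
      abs_of_pos (by positivity), smul_eq_mul, mul_one]
  have hconst : √((2 / Real.pi) ^ n) * (c * ((2 * Real.pi) ^ n * ((2 : ℝ) ^ n)⁻¹)) = 1 := by
    have hsqrt : √((2 / Real.pi) ^ n) * √((2 * Real.pi) ^ n) = 2 ^ n := by
      rw [← Real.sqrt_mul (by positivity), ← mul_pow,
        show 2 / Real.pi * (2 * Real.pi) = 2 ^ 2 by field_simp, ← pow_mul, mul_comm 2 n,
        pow_mul, Real.sqrt_sq (by positivity)]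
    have hpi : (2 * Real.pi) ^ n ≠ 0 := by positivity
    calc _ = (√((2 / Real.pi) ^ n) * √((2 * Real.pi) ^ n)) *
          (((2 * Real.pi) ^ n)⁻¹ * (2 * Real.pi) ^ n) * ((2 : ℝ) ^ n)⁻¹ := by rw [hc]; ring
      _ = 1 := by rw [hsqrt, inv_mul_cancel₀ hpi, mul_one, mul_inv_cancel₀ (by positivity)]
  simp only [hintegrand]
  rw [integral_const_mul, Measure.volume_eq_prod,
    integral_prod _ (integrable_integral_exp_mul_wignerProduct_mul u φ φ x)]
  simp only [hslice]
  rw [integral_const_mul, integral_complex_ofReal, hnorm]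
  have hconst' := congrArg (fun r : ℝ ↦ (r : ℂ) * u x) hconst
  simp only [Complex.ofReal_mul, Complex.ofReal_one, one_mul] at hconst'
  refine hconst'.symm.trans ?_
  ring
end

section
/- Let n ≥ 1, let a ∈ 𝒮(ℝ^{2n}), and let u, φ ∈ 𝒮(ℝ^n) with ‖φ‖_{L²} = 1. Then the intertwining relation W_φ(Â u) = Ã(W_φ u) holds pointwise on ℝ^{2n}, where Â is the Weyl operator with symbol a and Ã is the phase-space operator associated with Ω = J (i.e. ω = σ) and symbol a. -/
open MeasureTheory Matrix ComplexConjugate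

/-- The standard symplectic form `σ(z,z') = ξ·x' − ξ'·x` for `z = (x,ξ)`. -/
noncomputable def sigmaForm {n : ℕ}
    (z z' : (Fin n → ℝ) × (Fin n → ℝ)) : ℝ :=
  z.2 ⬝ᵥ z'.1 - z'.2 ⬝ᵥ z.1

/-- The Weyl operator with symbol `a`:
`Âu(x) = (2π)^{-n} ∬ e^{i(x−y)·ξ} a((x+y)/2, ξ) u(y) dy dξ`. -/
noncomputable def weylOp {n : ℕ} (a : ((Fin n → ℝ) × (Fin n → ℝ)) → ℂ)
    (u : (Fin n → ℝ) → ℂ) (x : Fin n → ℝ) : ℂ :=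
  ((((2 * Real.pi) ^ n : ℝ)⁻¹ : ℝ) : ℂ) *
    ∫ p : (Fin n → ℝ) × (Fin n → ℝ),
      Complex.exp (Complex.I * (((x - p.1) ⬝ᵥ p.2 : ℝ) : ℂ)) *
        a ((1/2 : ℝ) • (x + p.1), p.2) * u p.1

/-- The symplectic Fourier transform `F_σ`. -/
noncomputable def Fsigma {n : ℕ} (a : ((Fin n → ℝ) × (Fin n → ℝ)) → ℂ)
    (z : (Fin n → ℝ) × (Fin n → ℝ)) : ℂ :=
  ((((2 * Real.pi) ^ n : ℝ)⁻¹ : ℝ) : ℂ) *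
    ∫ z' : (Fin n → ℝ) × (Fin n → ℝ),
      Complex.exp (-Complex.I * ((sigmaForm z z' : ℝ) : ℂ)) * a z'

/-- The phase-space operator `Ã` (with `Ω = J`, i.e. `ω = σ`) with symbol `a`:
`ÃU(z) = (2π)^{-n} ∫ F_σa(z₀) e^{-iσ(z,z₀)} U(z − z₀/2) dz₀`. -/
noncomputable def AtildeSigma {n : ℕ} (a U : ((Fin n → ℝ) × (Fin n → ℝ)) → ℂ)
    (z : (Fin n → ℝ) × (Fin n → ℝ)) : ℂ :=
  ((((2 * Real.pi) ^ n : ℝ)⁻¹ : ℝ) : ℂ) *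
    ∫ z₀ : (Fin n → ℝ) × (Fin n → ℝ),
      Fsigma a z₀ * Complex.exp (-Complex.I * ((sigmaForm z z₀ : ℝ) : ℂ)) *
        U (z - (1/2 : ℝ) • z₀)

open scoped FourierTransform SchwartzMap

theorem norm_exp_neg_I_mul_ofReal (t : ℝ) : ‖Complex.exp (-Complex.I * (t : ℂ))‖ = 1 := by
  simpa using Complex.norm_exp_I_mul_ofReal (-t)

/-- Fourier inversion on `ι → ℝ`, with the normalization `ĝ(ξ) = ∫ e^{-iξ·y} g(y) dy`. -/
theorem integral_exp_mul_integral_exp_eq {ι : Type*} [Fintype ι] {g : (ι → ℝ) → ℂ}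
    (hcont : Continuous g) (hint : Integrable g)
    (hhat : Integrable fun ξ : ι → ℝ =>
      ∫ y : ι → ℝ, Complex.exp (-Complex.I * ((ξ ⬝ᵥ y : ℝ) : ℂ)) * g y)
    (x : ι → ℝ) :
    ∫ ξ : ι → ℝ, Complex.exp (Complex.I * ((ξ ⬝ᵥ x : ℝ) : ℂ)) *
        ∫ y : ι → ℝ, Complex.exp (-Complex.I * ((ξ ⬝ᵥ y : ℝ) : ℂ)) * g y =
      (((2 * Real.pi) ^ Fintype.card ι : ℝ) : ℂ) * g x := by
  set ghat : (ι → ℝ) → ℂ := fun ξ =>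
    ∫ y : ι → ℝ, Complex.exp (-Complex.I * ((ξ ⬝ᵥ y : ℝ) : ℂ)) * g y with hghat
  have hmp := PiLp.volume_preserving_ofLp ι
  have hemb : MeasurableEmbedding (@WithLp.ofLp 2 (ι → ℝ)) :=
    (MeasurableEquiv.toLp 2 (ι → ℝ)).symm.measurableEmbedding
  set G : EuclideanSpace ℝ ι → ℂ := fun v => g (WithLp.ofLp v) with hG
  have hGhat : 𝓕 G = fun w => ghat ((2 * Real.pi) • WithLp.ofLp w) := by
    ext w
    rw [Real.fourier_eq', hghat]
    simp only
    rw [← hmp.integral_comp hemb]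
    refine integral_congr_ae (.of_forall fun v => ?_)
    simp only [smul_eq_mul, hG]
    congr 2
    rw [EuclideanSpace.inner_eq_star_dotProduct]
    simp only [star_trivial, smul_dotProduct, smul_eq_mul]
    push_cast
    ring
  have hGcont : Continuous G := hcont.comp (PiLp.continuous_ofLp 2 _)
  have hGint : Integrable G := (hmp.integrable_comp_emb hemb).2 hint
  have hGhatint : Integrable (𝓕 G) := by
    rw [hGhat]
    exact (hmp.integrable_comp_emb hemb (g := fun w => ghat ((2 * Real.pi) • w))).2
      (hhat.comp_smul (by positivity))
  have hinv := congrFun (hGcont.fourierInv_fourier_eq hGint hGhatint) (WithLp.toLp 2 x)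
  rw [Real.fourierInv_eq', hGhat] at hinv
  simp only [hG, smul_eq_mul] at hinv
  rw [← hinv]
  have hscale := Measure.integral_comp_smul (volume : Measure (ι → ℝ))
    (fun ξ => Complex.exp (Complex.I * ((ξ ⬝ᵥ x : ℝ) : ℂ)) * ghat ξ) (2 * Real.pi)
  rw [← hmp.integral_comp hemb, Module.finrank_fintype_fun_eq_card,
    abs_of_nonneg (by positivity)] at hscale
  have hne : ((2 * Real.pi) ^ Fintype.card ι : ℝ) ≠ 0 := by positivity
  rw [eq_inv_smul_iff₀ hne] at hscale
  rw [← hscale, Complex.real_smul]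
  congr 1
  refine integral_congr_ae (.of_forall fun v => ?_)
  simp only
  congr 2
  rw [EuclideanSpace.inner_eq_star_dotProduct, dotProduct_comm]
  simp only [star_trivial, dotProduct_smul, smul_eq_mul]
  rw [dotProduct_comm]
  push_cast
  ring

theorem isAddHaarMeasure_volume_prod (n : ℕ) :
    (volume : Measure ((Fin n → ℝ) × (Fin n → ℝ))).IsAddHaarMeasure :=
  Measure.prod.instIsAddHaarMeasure (volume : Measure (Fin n → ℝ)) volume

/-- The symplectic Fourier transform of a Schwartz function is integrable. -/
theorem integrable_Fsigma {n : ℕ} (a : 𝓢((Fin n → ℝ) × (Fin n → ℝ), ℂ)) :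
    Integrable (Fsigma fun w => a w) := by
  have := isAddHaarMeasure_volume_prod n
  let S := ContinuousLinearEquiv.sumPiEquivProdPi ℝ (Fin n) (Fin n) (fun _ => ℝ)
  let L : EuclideanSpace ℝ (Fin n ⊕ Fin n) ≃L[ℝ] (Fin n → ℝ) × (Fin n → ℝ) :=
    (EuclideanSpace.equiv (Fin n ⊕ Fin n) ℝ).trans S
  have hL : MeasurePreserving L :=
    (volume_measurePreserving_sumPiEquivProdPi (fun _ : Fin n ⊕ Fin n => ℝ)).comp
      (PiLp.volume_preserving_ofLp (Fin n ⊕ Fin n))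
  let M : ((Fin n → ℝ) × (Fin n → ℝ)) ≃L[ℝ] EuclideanSpace ℝ (Fin n ⊕ Fin n) :=
    (((ContinuousLinearEquiv.prodComm ℝ (Fin n → ℝ) (Fin n → ℝ)).trans
      ((ContinuousLinearEquiv.refl ℝ (Fin n → ℝ)).prodCongr (ContinuousLinearEquiv.neg ℝ))).trans
      L.symm).trans (ContinuousLinearEquiv.smulLeft (Units.mk0 (2 * Real.pi)⁻¹ (by positivity)))
  let f : 𝓢((Fin n → ℝ) × (Fin n → ℝ), ℂ) :=
    SchwartzMap.compCLMOfContinuousLinearEquiv ℂ M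
      (𝓕 (SchwartzMap.compCLMOfContinuousLinearEquiv ℂ L a))
  refine (f.integrable.const_mul ((((2 * Real.pi) ^ n : ℝ)⁻¹ : ℝ) : ℂ)).congr
    (.of_forall fun z => ?_)
  simp only [Fsigma, f, SchwartzMap.compCLMOfContinuousLinearEquiv_apply, Function.comp_apply,
    SchwartzMap.fourier_coe, Real.fourier_eq']
  congr 1
  rw [← hL.integral_comp L.toHomeomorph.measurableEmbedding]
  refine integral_congr_ae (.of_forall fun v => ?_)
  simp only [smul_eq_mul]
  congr 2
  have hM : inner ℝ v (M z) = (2 * Real.pi)⁻¹ * sigmaForm z (L v) := by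
    have hMl (i : Fin n) : M z (Sum.inl i) = (2 * Real.pi)⁻¹ * z.2 i := rfl
    have hMr (i : Fin n) : M z (Sum.inr i) = (2 * Real.pi)⁻¹ * -z.1 i := rfl
    have hL₁ (i : Fin n) : (L v).1 i = v (Sum.inl i) := rfl
    have hL₂ (i : Fin n) : (L v).2 i = v (Sum.inr i) := rfl
    simp only [EuclideanSpace.inner_eq_star_dotProduct, star_trivial, sigmaForm, dotProduct,
      Fintype.sum_sum_type, hMl, hMr, hL₁, hL₂, ← Finset.sum_add_distrib,
      ← Finset.sum_sub_distrib, Finset.mul_sum]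
    exact Finset.sum_congr rfl fun i _ => by ring
  rw [hM]
  push_cast
  field_simp

/-- A Schwartz function on a product is dominated by an integrable function of the second
variable alone. -/
theorem SchwartzMap.exists_integrable_bound_snd {n : ℕ}
    (a : 𝓢((Fin n → ℝ) × (Fin n → ℝ), ℂ)) :
    ∃ k : (Fin n → ℝ) → ℝ, Integrable k ∧ ∀ w η, ‖a (w, η)‖ ≤ k η := by
  set C : ℝ := 2 ^ (n + 1) *
    (Finset.Iic (n + 1, 0)).sup (fun m => SchwartzMap.seminorm ℝ m.1 m.2) a
  refine ⟨fun η => C * (1 + ‖η‖) ^ (-((n + 1 : ℕ) : ℝ)), Integrable.const_mul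
    (integrable_one_add_norm (by simp)) C, fun w η => ?_⟩
  have h := SchwartzMap.one_add_le_sup_seminorm_apply (𝕜 := ℝ) (m := (n + 1, 0)) le_rfl le_rfl a
    (w, η)
  rw [norm_iteratedFDeriv_zero] at h
  beta_reduce
  rw [Real.rpow_neg (by positivity), Real.rpow_natCast, ← div_eq_mul_inv,
    le_div_iff₀ (by positivity), mul_comm]
  refine le_trans ?_ h
  gcongr
  exact norm_snd_le (w, η)

/-- The partial inverse Fourier transform of a symbol in the momentum variable. -/
noncomputable def momentumFourier {n : ℕ} (a : (Fin n → ℝ) × (Fin n → ℝ) → ℂ)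
    (t w : Fin n → ℝ) : ℂ :=
  ∫ η : Fin n → ℝ, Complex.exp (Complex.I * ((t ⬝ᵥ η : ℝ) : ℂ)) * a (w, η)

section

variable {n : ℕ} (a : 𝓢((Fin n → ℝ) × (Fin n → ℝ), ℂ))

theorem continuous_momentumFourier (t : Fin n → ℝ) :
    Continuous (momentumFourier (fun w => a w) t) := by
  obtain ⟨k, hk, hak⟩ := a.exists_integrable_bound_snd
  have ha := a.continuous
  refine continuous_of_dominated (bound := k) (fun w => ?_) (fun w => .of_forall fun η => ?_) hk
    (.of_forall fun η => ?_)
  · exact Continuous.aestronglyMeasurable (by fun_prop)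
  · simpa using hak w η
  · fun_prop

theorem integrable_exp_mul_symbol (f : (Fin n → ℝ) × (Fin n → ℝ) → ℝ) (hf : Continuous f) :
    Integrable (fun p => Complex.exp (Complex.I * (f p : ℂ)) * a p)
      ((volume : Measure (Fin n → ℝ)).prod volume) := by
  have := isAddHaarMeasure_volume_prod n
  exact a.integrable.bdd_mul (c := 1) (by fun_prop) (.of_forall fun p => by simp)

theorem integrable_momentumFourier (t : Fin n → ℝ) :
    Integrable (momentumFourier (fun w => a w) t) :=
  (integrable_exp_mul_symbol a (fun p => t ⬝ᵥ p.2) (by fun_prop)).integral_prod_left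

theorem integral_exp_mul_momentumFourier (t ξ : Fin n → ℝ) :
    ∫ y : Fin n → ℝ, Complex.exp (-Complex.I * ((ξ ⬝ᵥ y : ℝ) : ℂ)) *
        momentumFourier (fun w => a w) t y =
      (((2 * Real.pi) ^ n : ℝ) : ℂ) * Fsigma (fun w => a w) (t, ξ) := by
  have hne : (((2 * Real.pi) ^ n : ℝ) : ℂ) ≠ 0 := by
    exact_mod_cast (by positivity : ((2 * Real.pi) ^ n : ℝ) ≠ 0)
  have h := integral_prod _ (integrable_exp_mul_symbol a (fun p => -sigmaForm (t, ξ) p)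
    (by unfold sigmaForm; fun_prop))
  simp only [Complex.ofReal_neg, mul_neg, ← neg_mul] at h
  rw [Fsigma, Complex.ofReal_inv, mul_inv_cancel_left₀ hne, Measure.volume_eq_prod, h]
  refine integral_congr_ae (.of_forall fun y => ?_)
  simp only [momentumFourier]
  rw [← integral_const_mul]
  refine integral_congr_ae (.of_forall fun η => ?_)
  simp only [sigmaForm]
  rw [← mul_assoc, ← Complex.exp_add, dotProduct_comm t η]
  congr 2
  push_cast
  ring

theorem ae_integral_exp_mul_Fsigma : ∀ᵐ t : Fin n → ℝ, ∀ w : Fin n → ℝ,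
    ∫ ξ : Fin n → ℝ, Complex.exp (Complex.I * ((ξ ⬝ᵥ w : ℝ) : ℂ)) * Fsigma (fun w => a w) (t, ξ) =
      momentumFourier (fun w => a w) t w := by
  have hF := integrable_Fsigma a
  rw [Measure.volume_eq_prod] at hF
  have hne : (((2 * Real.pi) ^ n : ℝ) : ℂ) ≠ 0 := by
    exact_mod_cast (by positivity : ((2 * Real.pi) ^ n : ℝ) ≠ 0)
  filter_upwards [hF.prod_right_ae] with t ht w
  have h := integral_exp_mul_integral_exp_eq (continuous_momentumFourier a t)
    (integrable_momentumFourier a t)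
    (by simpa only [integral_exp_mul_momentumFourier] using ht.const_mul _) w
  simp only [integral_exp_mul_momentumFourier, mul_left_comm _ (((2 * Real.pi) ^ n : ℝ) : ℂ),
    integral_const_mul, Fintype.card_fin] at h
  exact mul_left_cancel₀ hne h

theorem integrable_weyl_integrand (u : 𝓢(Fin n → ℝ, ℂ)) (x : Fin n → ℝ) :
    Integrable (fun p : (Fin n → ℝ) × (Fin n → ℝ) =>
      Complex.exp (Complex.I * (((x - p.1) ⬝ᵥ p.2 : ℝ) : ℂ)) *
        a ((1/2 : ℝ) • (x + p.1), p.2) * u p.1)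
      ((volume : Measure (Fin n → ℝ)).prod volume) := by
  obtain ⟨k, hk, hak⟩ := a.exists_integrable_bound_snd
  have ha := a.continuous
  have hu := u.continuous
  refine (u.integrable.norm.mul_prod hk).mono' (Continuous.aestronglyMeasurable (by fun_prop))
    (.of_forall fun p => ?_)
  rw [norm_mul, norm_mul, Complex.norm_exp_I_mul_ofReal, one_mul, mul_comm]
  gcongr
  exact hak _ _

theorem integrable_Fsigma_mul {f : (Fin n → ℝ) × (Fin n → ℝ) → ℝ} (hf : Continuous f)
    (u : 𝓢(Fin n → ℝ, ℂ)) (x : Fin n → ℝ) :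
    Integrable (fun p => Fsigma (fun w => a w) p * Complex.exp (Complex.I * (f p : ℂ)) *
        u (x - p.1)) ((volume : Measure (Fin n → ℝ)).prod volume) := by
  obtain ⟨C, -, hC⟩ := u.decay 0 0
  have hu := u.continuous
  have h := (integrable_Fsigma a).mul_bdd (c := C)
    (g := fun p => Complex.exp (Complex.I * (f p : ℂ)) * u (x - p.1))
    (Continuous.aestronglyMeasurable (by fun_prop)) (.of_forall fun p => by
      simpa using hC (x - p.1))
  rw [Measure.volume_eq_prod] at h
  simpa only [mul_assoc] using h

/-- The Weyl operator as a superposition of Heisenberg–Weyl operators weighted by `F_σ a`. -/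
theorem weylOp_eq_integral_Fsigma (u : 𝓢(Fin n → ℝ, ℂ)) (x : Fin n → ℝ) :
    weylOp (fun w => a w) (fun w => u w) x =
      ((((2 * Real.pi) ^ n : ℝ)⁻¹ : ℝ) : ℂ) * ∫ z₀ : (Fin n → ℝ) × (Fin n → ℝ),
        Fsigma (fun w => a w) z₀ *
          Complex.exp (Complex.I * ((z₀.2 ⬝ᵥ (x - (1/2 : ℝ) • z₀.1) : ℝ) : ℂ)) *
          u (x - z₀.1) := by
  rw [weylOp]
  congr 1
  rw [Measure.volume_eq_prod, integral_prod _ (integrable_weyl_integrand a u x),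
    integral_prod _ (integrable_Fsigma_mul a (by fun_prop) u x)]
  rw [← integral_sub_left_eq_self _ volume x]
  refine integral_congr_ae ?_
  filter_upwards [ae_integral_exp_mul_Fsigma a] with t ht
  simp only [integral_mul_const]
  congr 1
  simp only [mul_comm (Fsigma _ _), ht, momentumFourier]
  refine integral_congr_ae (.of_forall fun η => ?_)
  simp only [sub_sub_cancel]
  congr 3
  module

theorem crossWigner_weylOp (u φ : 𝓢(Fin n → ℝ, ℂ)) (z : (Fin n → ℝ) × (Fin n → ℝ)) :
    crossWigner (weylOp (fun w => a w) (fun w => u w)) (fun w => φ w) z =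
      AtildeSigma (fun w => a w) (crossWigner (fun w => u w) (fun w => φ w)) z := by
  have hφ : Integrable fun y : Fin n → ℝ => conj (φ (z.1 - (1/2 : ℝ) • y)) :=
    (Complex.conjCLE : ℂ →L[ℝ] ℂ).integrable_comp
      ((φ.integrable.comp_sub_left z.1).comp_smul (by norm_num : (1/2 : ℝ) ≠ 0))
  obtain ⟨C, -, hC⟩ := u.decay 0 0
  have hu := u.continuous
  let Φ : (Fin n → ℝ) → (Fin n → ℝ) × (Fin n → ℝ) → ℂ := fun y z₀ =>
    conj (φ (z.1 - (1/2 : ℝ) • y)) * Fsigma (fun w => a w) z₀ *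
      (Complex.exp (-Complex.I * ((z.2 ⬝ᵥ y : ℝ) : ℂ)) *
        Complex.exp (Complex.I *
          ((z₀.2 ⬝ᵥ (z.1 + (1/2 : ℝ) • y - (1/2 : ℝ) • z₀.1) : ℝ) : ℂ)) *
        u (z.1 + (1/2 : ℝ) • y - z₀.1))
  have hΦ : Integrable (Function.uncurry Φ) (volume.prod volume) := by
    refine (hφ.mul_prod (integrable_Fsigma a)).mul_bdd (c := C)
      (Continuous.aestronglyMeasurable (by fun_prop)) (.of_forall fun p => ?_)
    rw [norm_mul, norm_mul, norm_exp_neg_I_mul_ofReal, Complex.norm_exp_I_mul_ofReal]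
    simpa using hC (z.1 + (1/2 : ℝ) • p.1 - p.2.1)
  have hleft (y : Fin n → ℝ) : Complex.exp (-Complex.I * ((z.2 ⬝ᵥ y : ℝ) : ℂ)) *
      weylOp (fun w => a w) (fun w => u w) (z.1 + (1/2 : ℝ) • y) *
        conj (φ (z.1 - (1/2 : ℝ) • y)) =
      ((((2 * Real.pi) ^ n : ℝ)⁻¹ : ℝ) : ℂ) * ∫ z₀, Φ y z₀ := by
    rw [weylOp_eq_integral_Fsigma, mul_left_comm, mul_assoc]
    rw [← integral_const_mul, ← integral_mul_const]
    congr 2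
    ext z₀
    simp only [Φ]
    ring
  have hright (z₀ : (Fin n → ℝ) × (Fin n → ℝ)) : Fsigma (fun w => a w) z₀ *
      Complex.exp (-Complex.I * ((sigmaForm z z₀ : ℝ) : ℂ)) *
        crossWigner (fun w => u w) (fun w => φ w) (z - (1/2 : ℝ) • z₀) =
      ((((2 * Real.pi) ^ n : ℝ)⁻¹ : ℝ) : ℂ) * ∫ y, Φ y z₀ := by
    rw [crossWigner, mul_left_comm, ← integral_add_right_eq_self (fun y => Φ y z₀) z₀.1,
      ← integral_const_mul]
    congr 2
    ext y
    have hx : z.1 + (1/2 : ℝ) • (y + z₀.1) - z₀.1 =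
        (z - (1/2 : ℝ) • z₀).1 + (1/2 : ℝ) • y := by
      simp only [Prod.fst_sub, Prod.smul_fst]; module
    have hx' : z.1 - (1/2 : ℝ) • (y + z₀.1) = (z - (1/2 : ℝ) • z₀).1 - (1/2 : ℝ) • y := by
      simp only [Prod.fst_sub, Prod.smul_fst]; module
    have hphase : Complex.exp (-Complex.I * ((sigmaForm z z₀ : ℝ) : ℂ)) *
        Complex.exp (-Complex.I * (((z - (1/2 : ℝ) • z₀).2 ⬝ᵥ y : ℝ) : ℂ)) =
        Complex.exp (-Complex.I * ((z.2 ⬝ᵥ (y + z₀.1) : ℝ) : ℂ)) *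
        Complex.exp (Complex.I *
          ((z₀.2 ⬝ᵥ (z.1 + (1/2 : ℝ) • (y + z₀.1) - (1/2 : ℝ) • z₀.1) : ℝ) : ℂ)) := by
      rw [← Complex.exp_add, ← Complex.exp_add]
      congr 1
      simp only [sigmaForm, Prod.snd_sub, Prod.smul_snd, sub_dotProduct, smul_dotProduct,
        dotProduct_add, dotProduct_sub, dotProduct_smul, smul_eq_mul]
      push_cast
      ring
    simp only [Φ, hx, hx', ← hphase]
    ring
  simp only [crossWigner, AtildeSigma] at hright ⊢
  simp only [hleft, hright, integral_const_mul, integral_integral_swap hΦ]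

end

/-- the intertwining relation `W_φ(Âu) = Ã(W_φu)`. -/
theorem stmt13 (n : ℕ) (hn : 1 ≤ n)
    (a : SchwartzMap ((Fin n → ℝ) × (Fin n → ℝ)) ℂ)
    (u φ : SchwartzMap (Fin n → ℝ) ℂ)
    (hφ : ∫ x : Fin n → ℝ, ‖φ x‖ ^ 2 = 1)
    (z : (Fin n → ℝ) × (Fin n → ℝ)) :
    wavePacket (fun w => φ w) (weylOp (fun w => a w) (fun w => u w)) z
      = AtildeSigma (fun w => a w) (wavePacket (fun w => φ w) (fun w => u w)) z := by
  simp only [wavePacket, crossWigner_weylOp, AtildeSigma, mul_left_comm _ (Real.sqrt _ : ℂ),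
    integral_const_mul]
end

section
/- Let n ≥ 1, let f be an invertible real 2n×2n matrix, and let (φ_j)_{j∈ℕ} be a Hilbert basis (complete orthonormal system) of L²(ℝ^n). For j, k ∈ ℕ define Φ_{j,k}(z) = (2π)^{n/2} |det f|^{-1/2} W(φ_k, φ_j)(f^{-1} z). Then the family (Φ_{j,k})_{(j,k)∈ℕ×ℕ} is a Hilbert basis of L²(ℝ^{2n}). -/
open MeasureTheory Matrix ComplexConjugate

/-- Split a vector in `ℝ^{2n}` into the pair `(x, ξ) ∈ ℝ^n × ℝ^n`. -/
def splitVec (n : ℕ) (z : Fin (2 * n) → ℝ) : (Fin n → ℝ) × (Fin n → ℝ) :=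
  (fun i => z ⟨(i : ℕ), by have := i.isLt; omega⟩,
   fun i => z ⟨n + (i : ℕ), by have := i.isLt; omega⟩)

theorem memLp_two_comp_of_map_eq_smul {α β : Type*} [MeasurableSpace α] [MeasurableSpace β]
    {μ : Measure α} {ν : Measure β} (e : α ≃ᵐ β) {c : ℝ}
    (hmap : μ.map e = ENNReal.ofReal c • ν) {g : β → ℂ} (hg : MemLp g 2 ν) :
    MemLp (fun x => g (e x)) 2 μ := by
  have h : MemLp g 2 (μ.map e) := by
    rw [hmap]
    exact hg.smul_measure ENNReal.ofReal_ne_top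
  exact h.comp_of_map e.measurable.aemeasurable

theorem quasiMeasurePreserving_of_map_eq_smul {α β : Type*} [MeasurableSpace α]
    [MeasurableSpace β] {μ : Measure α} {ν : Measure β} (e : α ≃ᵐ β) {c : ℝ}
    (hmap : μ.map e = ENNReal.ofReal c • ν) : Measure.QuasiMeasurePreserving e μ ν := by
  refine ⟨e.measurable, ?_⟩
  rw [hmap]
  exact Measure.smul_absolutelyContinuous

/-- Weighted composition with a measurable equivalence that rescales the measure is unitary. -/
theorem exists_unitary_comp {α β : Type*} [MeasurableSpace α] [MeasurableSpace β]
    {μ : Measure α} {ν : Measure β} (e : α ≃ᵐ β) {c : ℝ} (hc : 0 < c)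
    (hmap : μ.map e = ENNReal.ofReal c • ν) :
    ∃ U : Lp ℂ 2 ν ≃ₗᵢ[ℂ] Lp ℂ 2 μ,
      ∀ g : Lp ℂ 2 ν, U g =ᵐ[μ] fun x => (((√c)⁻¹ : ℝ) : ℂ) * g (e x) := by
  have hsqrt : ((√c : ℝ) : ℂ) ≠ 0 := by
    exact_mod_cast (Real.sqrt_pos.2 hc).ne'
  have hqmp := quasiMeasurePreserving_of_map_eq_smul e hmap
  have hmap' : ν.map e.symm = ENNReal.ofReal c⁻¹ • μ := by
    have h : (μ.map e).map e.symm = μ := by simp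
    rw [hmap, Measure.map_smul] at h
    rw [← h, smul_smul, ← ENNReal.ofReal_mul (by positivity), inv_mul_cancel₀ hc.ne']
    simp
  have hqmp' := quasiMeasurePreserving_of_map_eq_smul e.symm hmap'
  have hfwd (g : Lp ℂ 2 ν) : MemLp (fun x => (((√c)⁻¹ : ℝ) : ℂ) * g (e x)) 2 μ :=
    (memLp_two_comp_of_map_eq_smul e hmap (Lp.memLp g)).const_mul _
  have hbwd (g : Lp ℂ 2 μ) : MemLp (fun x => ((√c : ℝ) : ℂ) * g (e.symm x)) 2 ν :=
    (memLp_two_comp_of_map_eq_smul e.symm hmap' (Lp.memLp g)).const_mul _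
  let L : Lp ℂ 2 ν ≃ₗ[ℂ] Lp ℂ 2 μ :=
    { toFun := fun g => (hfwd g).toLp
      invFun := fun g => (hbwd g).toLp
      map_add' := by
        intro g h
        apply Lp.ext
        filter_upwards [(hfwd (g + h)).coeFn_toLp, (hfwd g).coeFn_toLp, (hfwd h).coeFn_toLp,
          Lp.coeFn_add (hfwd g).toLp (hfwd h).toLp, hqmp.ae (Lp.coeFn_add g h)] with x h1 h2 h3 h4 h5
        rw [h1, h4, Pi.add_apply, h2, h3, h5, Pi.add_apply]
        ring
      map_smul' := by
        intro a g
        apply Lp.ext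
        filter_upwards [(hfwd (a • g)).coeFn_toLp, (hfwd g).coeFn_toLp,
          Lp.coeFn_smul a (hfwd g).toLp, hqmp.ae (Lp.coeFn_smul a g)] with x h1 h2 h4 h5
        rw [h1, RingHom.id_apply, h4, Pi.smul_apply, h2, h5, Pi.smul_apply]
        simp only [smul_eq_mul]
        ring
      left_inv := by
        intro g
        apply Lp.ext
        filter_upwards [(hbwd (hfwd g).toLp).coeFn_toLp, hqmp'.ae (hfwd g).coeFn_toLp] with x h1 h2
        rw [h1, h2, e.apply_symm_apply]
        push_cast
        field_simp
      right_inv := by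
        intro g
        apply Lp.ext
        filter_upwards [(hfwd (hbwd g).toLp).coeFn_toLp, hqmp.ae (hbwd g).coeFn_toLp] with x h1 h2
        rw [h1, h2, e.symm_apply_apply]
        push_cast
        field_simp }
  refine ⟨⟨L, fun g => ?_⟩, fun g => (hfwd g).coeFn_toLp⟩
  change ‖(hfwd g).toLp‖ = ‖g‖
  rw [Lp.norm_toLp, Lp.norm_def]
  congr 1
  have h1 : eLpNorm (fun x => g (e x)) 2 μ = ENNReal.ofReal √c * eLpNorm g 2 ν := by
    have := eLpNorm_map_measure (p := 2) (g := g) (f := e) (μ := μ)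
      (by rw [hmap]; exact (Lp.aestronglyMeasurable g).smul_measure _) e.measurable.aemeasurable
    rw [hmap, eLpNorm_smul_measure_of_ne_zero (by simpa using hc)] at this
    rw [show (fun x => g (e x)) = g ∘ e from rfl, ← this, smul_eq_mul]
    congr 1
    rw [Real.sqrt_eq_rpow, ← ENNReal.ofReal_rpow_of_pos hc]
    simp
  have h2 := eLpNorm_const_smul (((√c)⁻¹ : ℝ) : ℂ) (fun x => g (e x)) 2 μ
  have h3 : (fun x => (((√c)⁻¹ : ℝ) : ℂ) * g (e x)) = (((√c)⁻¹ : ℝ) : ℂ) • fun x => g (e x) := rfl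
  rw [h3, h2, h1, ← mul_assoc, ← ofReal_norm, ← ENNReal.ofReal_mul (by positivity)]
  rw [Complex.norm_real, Real.norm_of_nonneg (by positivity), inv_mul_cancel₀ (Real.sqrt_pos.2 hc).ne']
  simp

open FourierTransform in
/-- On `L¹ ∩ L²` the Fourier integral agrees with the `L²` Fourier transform. -/
theorem fourier_toLp_two_ae_eq {E : Type*} [NormedAddCommGroup E] [MeasurableSpace E]
    [BorelSpace E] [InnerProductSpace ℝ E] [FiniteDimensional ℝ E] {h : E → ℂ}
    (h1 : Integrable h) (h2 : MemLp h 2) :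
    (Lp.fourierTransformₗᵢ E ℂ h2.toLp : E → ℂ) =ᵐ[volume] 𝓕 h := by
  have hcont : Continuous (𝓕 h) :=
    VectorFourier.fourierIntegral_continuous Real.continuous_fourierChar
      (by exact continuous_inner) h1
  refine ae_eq_of_integral_contDiff_smul_eq
    ((Lp.memLp _).locallyIntegrable (by norm_num)) hcont.locallyIntegrable fun g hg hgs => ?_
  have hgs' : HasCompactSupport fun x => (g x : ℂ) :=
    hgs.comp_left (g := fun r : ℝ => (r : ℂ)) Complex.ofReal_zero
  let G : SchwartzMap E ℂ := hgs'.toSchwartzMap (Complex.ofRealCLM.contDiff.comp hg)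
  have hG : ∀ x, G x = (g x : ℂ) := fun x => rfl
  have hdist := congrArg (fun T => T G) (Lp.fourier_toTemperedDistribution_eq (h2.toLp h))
  simp only [TemperedDistribution.fourier_apply, Lp.toTemperedDistribution_apply] at hdist
  have hflip := VectorFourier.integral_fourierIntegral_smul_eq_flip (L := innerₗ E)
    (μ := volume) (ν := volume)
    Real.continuous_fourierChar (by exact continuous_inner) (G.integrable (μ := volume)) h1
  rw [flip_innerₗ] at hflip
  calc ∫ x, g x • (Lp.fourierTransformₗᵢ E ℂ h2.toLp : E → ℂ) x
      = ∫ x, G x • (𝓕 (h2.toLp h) : Lp ℂ 2 (volume : Measure E)) x := by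
        rfl
    _ = ∫ x, (𝓕 G) x • (h2.toLp h) x := hdist.symm
    _ = ∫ x, (𝓕 G) x • h x := by
        refine integral_congr_ae ?_
        filter_upwards [h2.coeFn_toLp] with x hx
        rw [hx]
    _ = ∫ x, G x • 𝓕 h x := by
        exact hflip
    _ = _ := rfl

theorem HilbertBasis.ext_inner {ι H : Type*} [NormedAddCommGroup H] [InnerProductSpace ℂ H]
    (b : HilbertBasis ι ℂ H) {u v : H} (h : ∀ i, inner ℂ (b i) u = inner ℂ (b i) v) : u = v := by
  apply b.repr.injective
  ext i
  rw [b.repr_apply_apply, b.repr_apply_apply, h]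

/-- The image of a Hilbert basis under a unitary map. -/
noncomputable def HilbertBasis.mapUnitary {ι H K : Type*} [NormedAddCommGroup H]
    [InnerProductSpace ℂ H] [NormedAddCommGroup K] [InnerProductSpace ℂ K]
    (b : HilbertBasis ι ℂ H) (U : H ≃ₗᵢ[ℂ] K) : HilbertBasis ι ℂ K :=
  HilbertBasis.ofRepr (U.symm.trans b.repr)

theorem HilbertBasis.mapUnitary_apply {ι H K : Type*} [NormedAddCommGroup H]
    [InnerProductSpace ℂ H] [NormedAddCommGroup K] [InnerProductSpace ℂ K]
    (b : HilbertBasis ι ℂ H) (U : H ≃ₗᵢ[ℂ] K) (i : ι) : b.mapUnitary U i = U (b i) := by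
  classical
  rw [← HilbertBasis.repr_symm_single, ← HilbertBasis.repr_symm_single]
  rfl

theorem exists_hilbertBasis_of_forall_inner {ι H : Type*} [NormedAddCommGroup H]
    [InnerProductSpace ℂ H] [CompleteSpace H] {v : ι → H} (hv : Orthonormal ℂ v)
    (h : ∀ x, (∀ i, inner ℂ (v i) x = 0) → x = 0) :
    ∃ b : HilbertBasis ι ℂ H, ∀ i, b i = v i := by
  refine ⟨HilbertBasis.mkOfOrthogonalEqBot hv ?_, fun i =>
    congrFun (HilbertBasis.coe_mkOfOrthogonalEqBot hv _) i⟩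
  rw [Submodule.eq_bot_iff]
  intro x hx
  exact h x fun i => (Submodule.mem_orthogonal _ _).1 hx _ (Submodule.subset_span ⟨i, rfl⟩)

section Tensor

variable {X Y : Type*} [MeasurableSpace X] [MeasurableSpace Y] {μ : Measure X} {ν : Measure Y}

theorem MeasureTheory.MemLp.tensor {u : X → ℂ} {v : Y → ℂ} (hu : MemLp u 2 μ) (hv : MemLp v 2 ν) :
    MemLp (fun p : X × Y => u p.1 * v p.2) 2 (μ.prod ν) := by
  refine (memLp_two_iff_integrable_sq_norm (hu.1.comp_fst.mul hv.1.comp_snd)).2 ?_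
  refine (((memLp_two_iff_integrable_sq_norm hu.1).1 hu).mul_prod
    ((memLp_two_iff_integrable_sq_norm hv.1).1 hv)).congr (.of_forall fun p => ?_)
  simp [mul_pow]

/-- The elementary tensor `(x, y) ↦ u x * v y` in `L²`. -/
noncomputable def tensorLp (u : Lp ℂ 2 μ) (v : Lp ℂ 2 ν) : Lp ℂ 2 (μ.prod ν) :=
  ((Lp.memLp u).tensor (Lp.memLp v)).toLp

theorem coeFn_tensorLp (u : Lp ℂ 2 μ) (v : Lp ℂ 2 ν) :
    tensorLp u v =ᵐ[μ.prod ν] fun p => u p.1 * v p.2 :=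
  MemLp.coeFn_toLp _

theorem norm_sq_toLp_two {v : Y → ℂ} (hv : MemLp v 2 ν) :
    ‖hv.toLp‖ ^ 2 = ∫ y, ‖v y‖ ^ 2 ∂ν := by
  have h := inner_self_eq_norm_sq_to_K (𝕜 := ℂ) hv.toLp
  rw [L2.inner_def] at h
  have h' : ((‖hv.toLp‖ ^ 2 : ℝ) : ℂ) = ((∫ y, ‖v y‖ ^ 2 ∂ν : ℝ) : ℂ) := by
    push_cast
    rw [← integral_complex_ofReal]
    refine h.symm.trans (integral_congr_ae ?_)
    filter_upwards [hv.coeFn_toLp] with y hy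
    rw [hy, inner_self_eq_norm_sq_to_K]
    simp
  exact_mod_cast h'

variable [SFinite ν]

theorem ae_prod_eq_of_slices {F G : X × Y → ℂ} (hF : StronglyMeasurable F)
    (hG : StronglyMeasurable G) (h : ∀ᵐ x ∂μ, ∀ᵐ y ∂ν, F (x, y) = G (x, y)) :
    F =ᵐ[μ.prod ν] G := by
  exact (Measure.ae_prod_iff_ae_ae (p := fun z => F z = G z)
    (measurableSet_eq_fun hF.measurable hG.measurable)).2 h

variable [SFinite μ]

theorem inner_tensorLp (a a' : Lp ℂ 2 μ) (c c' : Lp ℂ 2 ν) :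
    inner ℂ (tensorLp a c) (tensorLp a' c') = inner ℂ a a' * inner ℂ c c' := by
  simp_rw [L2.inner_def]
  rw [← integral_prod_mul]
  refine integral_congr_ae ?_
  filter_upwards [coeFn_tensorLp a c, coeFn_tensorLp a' c'] with p h1 h2
  rw [h1, h2]
  simp only [RCLike.inner_apply, map_mul]
  ring

theorem memLp_two_slice {h : X × Y → ℂ} (hh : MemLp h 2 (μ.prod ν)) :
    ∀ᵐ x ∂μ, MemLp (fun y => h (x, y)) 2 ν := by
  have hint := ((memLp_two_iff_integrable_sq_norm hh.1).1 hh).prod_right_ae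
  filter_upwards [hint, hh.1.prodMk_left] with x h1 h2
  exact (memLp_two_iff_integrable_sq_norm h2).2 h1

/-- The partial inner product of `h ∈ L²(μ ⊗ ν)` with `c ∈ L²(ν)`. -/
theorem exists_partial_inner (c : Lp ℂ 2 ν) (h : Lp ℂ 2 (μ.prod ν)) :
    ∃ P : Lp ℂ 2 μ, (∀ a, inner ℂ (tensorLp a c) h = inner ℂ a P) ∧
      ∀ᵐ x ∂μ, ∀ hx : MemLp (fun y => h (x, y)) 2 ν, P x = inner ℂ c hx.toLp := by
  let P : X → ℂ := fun x => ∫ y, inner ℂ (c y) (h (x, y)) ∂ν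
  have hP (x : X) (hx : MemLp (fun y => h (x, y)) 2 ν) : P x = inner ℂ c hx.toLp := by
    rw [L2.inner_def]
    refine integral_congr_ae ?_
    filter_upwards [hx.coeFn_toLp] with y hy
    rw [hy]
  have hPm : AEStronglyMeasurable P μ := by
    apply AEStronglyMeasurable.integral_prod_right'
      (f := fun p : X × Y => inner ℂ (c p.2) (h p))
    exact (Lp.aestronglyMeasurable c).comp_snd.inner (Lp.aestronglyMeasurable h)
  have hPL : MemLp P 2 μ := by
    rw [memLp_two_iff_integrable_sq_norm hPm]
    have hint := ((memLp_two_iff_integrable_sq_norm (Lp.memLp h).1).1 (Lp.memLp h)).integral_prod_left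
    refine (hint.const_mul (‖c‖ ^ 2)).mono' (hPm.norm.pow 2) ?_
    filter_upwards [memLp_two_slice (Lp.memLp h)] with x hx
    rw [hP x hx, ← norm_sq_toLp_two hx, ← mul_pow, Real.norm_of_nonneg (by positivity)]
    gcongr
    exact norm_inner_le_norm _ _
  refine ⟨hPL.toLp, fun a => ?_, ?_⟩
  · rw [L2.inner_def, integral_prod _ (L2.integrable_inner _ _), L2.inner_def]
    refine integral_congr_ae ?_
    filter_upwards [hPL.coeFn_toLp, Measure.ae_ae_of_ae_prod (coeFn_tensorLp a c)] with x h1 h2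
    rw [h1, RCLike.inner_apply, mul_comm, ← integral_const_mul]
    refine integral_congr_ae ?_
    filter_upwards [h2] with y hy
    rw [hy]
    simp only [RCLike.inner_apply, map_mul]
    ring
  · filter_upwards [hPL.coeFn_toLp] with x h1 hx
    rw [h1, hP x hx]

theorem exists_tensor_hilbertBasis {ι κ : Type*} [Countable κ]
    (b : HilbertBasis ι ℂ (Lp ℂ 2 μ)) (c : HilbertBasis κ ℂ (Lp ℂ 2 ν)) :
    ∃ B : HilbertBasis (κ × ι) ℂ (Lp ℂ 2 (μ.prod ν)), ∀ p, B p = tensorLp (b p.2) (c p.1) := by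
  classical
  apply exists_hilbertBasis_of_forall_inner
  · rw [orthonormal_iff_ite]
    rintro ⟨k, i⟩ ⟨l, j⟩
    rw [inner_tensorLp, orthonormal_iff_ite.1 b.orthonormal, orthonormal_iff_ite.1 c.orthonormal]
    by_cases h1 : i = j <;> by_cases h2 : k = l <;> simp [h1, h2]
  · intro h hh
    choose P hP hPx using fun k => exists_partial_inner (μ := μ) (c k) h
    have hP0 (k : κ) : P k = 0 := b.ext_inner fun i => by
      rw [← hP, hh (k, i), inner_zero_right]
    apply Lp.ext
    refine Filter.EventuallyEq.trans ?_ (Lp.coeFn_zero _ _ _).symm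
    refine ae_prod_eq_of_slices (Lp.stronglyMeasurable h) stronglyMeasurable_zero ?_
    have h0 : ∀ᵐ x ∂μ, ∀ k, P k x = 0 := ae_all_iff.2 fun k => by
      rw [hP0]
      exact Lp.coeFn_zero _ _ _
    filter_upwards [h0, ae_all_iff.2 hPx, memLp_two_slice (Lp.memLp h)] with x h1 h2 hx
    have h3 : hx.toLp = 0 := c.ext_inner fun k => by
      rw [← h2 k hx, h1, inner_zero_right]
    have h4 := hx.coeFn_toLp
    rw [h3] at h4
    exact h4.symm.trans (Lp.coeFn_zero _ _ _)

/-- A unitary operator `F` on the second variable extends to a unitary operator on `L²(μ ⊗ ν)`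
acting on almost every slice as `F`. -/
theorem exists_unitary_slicewise {Z ι κ : Type*} [MeasurableSpace Z] {ρ : Measure Z} [SFinite ρ]
    [Countable κ] (b : HilbertBasis ι ℂ (Lp ℂ 2 μ)) (c : HilbertBasis κ ℂ (Lp ℂ 2 ν))
    (F : Lp ℂ 2 ν ≃ₗᵢ[ℂ] Lp ℂ 2 ρ) :
    ∃ T : Lp ℂ 2 (μ.prod ν) ≃ₗᵢ[ℂ] Lp ℂ 2 (μ.prod ρ),
      ∀ (h : Lp ℂ 2 (μ.prod ν)), ∀ᵐ x ∂μ, ∀ hx : MemLp (fun y => h (x, y)) 2 ν,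
        (fun z => T h (x, z)) =ᵐ[ρ] F hx.toLp := by
  obtain ⟨B, hB⟩ := exists_tensor_hilbertBasis b c
  obtain ⟨B', hB'⟩ := exists_tensor_hilbertBasis b (c.mapUnitary F)
  let T := B.repr.trans B'.repr.symm
  have hT (p : κ × ι) : T (B p) = B' p := by
    classical
    rw [← B'.repr_symm_single, LinearIsometryEquiv.trans_apply, B.repr_self]
  refine ⟨T, fun h => ?_⟩
  choose P hP hPx using fun k => exists_partial_inner (μ := μ) (c k) h
  choose Q hQ hQx using fun k => exists_partial_inner (μ := μ) (c.mapUnitary F k) (T h)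
  have hPQ (k : κ) : P k = Q k := b.ext_inner fun i => by
    rw [← hP, ← hQ, ← hB (k, i), ← hB' (k, i), ← hT, T.inner_map_map]
  filter_upwards [ae_all_iff.2 hPx, ae_all_iff.2 hQx, memLp_two_slice (Lp.memLp (T h))]
    with x h1 h2 hTx hx
  have h3 : hTx.toLp = F hx.toLp := (c.mapUnitary F).ext_inner fun k => by
    rw [← h2 k hTx, ← hPQ, h1 k hx, HilbertBasis.mapUnitary_apply, F.inner_map_map]
  rw [← h3]
  exact hTx.coeFn_toLp.symm

end Tensor

theorem exists_conj_hilbertBasis {ι Y : Type*} [MeasurableSpace Y] {ν : Measure Y}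
    (b : HilbertBasis ι ℂ (Lp ℂ 2 ν)) :
    ∃ c : HilbertBasis ι ℂ (Lp ℂ 2 ν), ∀ i, c i = star (b i) := by
  classical
  have hstar (u v : Lp ℂ 2 ν) : inner ℂ (star u) v = conj (inner ℂ u (star v)) := by
    rw [L2.inner_def, L2.inner_def, ← integral_conj]
    refine integral_congr_ae ?_
    filter_upwards [Lp.coeFn_star u, Lp.coeFn_star v] with x h1 h2
    rw [h1, h2]
    simp
  apply exists_hilbertBasis_of_forall_inner
  · rw [orthonormal_iff_ite]
    intro i j
    rw [hstar, star_star, orthonormal_iff_ite.1 b.orthonormal]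
    split_ifs <;> simp
  · intro x hx
    have h : star x = 0 := b.ext_inner fun i => by
      have := hx i
      rw [hstar, map_eq_zero] at this
      rw [this, inner_zero_right]
    rw [← star_star x, h]
    apply Lp.ext
    filter_upwards [Lp.coeFn_star (0 : Lp ℂ 2 ν), Lp.coeFn_zero ℂ 2 ν] with y h1 h2
    rw [h1, Pi.star_apply, h2]
    simp

/-- The unitary Fourier transform on `L²(ℝⁿ)` with kernel `(2π)^{-n/2} e^{-iξ·y}`. -/
theorem exists_unitary_fourier (n : ℕ) :
    ∃ G : Lp ℂ 2 (volume : Measure (Fin n → ℝ)) ≃ₗᵢ[ℂ] Lp ℂ 2 (volume : Measure (Fin n → ℝ)),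
      ∀ (h : (Fin n → ℝ) → ℂ) (_ : Integrable h) (h2 : MemLp h 2),
        G h2.toLp =ᵐ[volume] fun ξ => (((√((2 * Real.pi) ^ n))⁻¹ : ℝ) : ℂ) *
          ∫ y, Complex.exp (-Complex.I * ((ξ ⬝ᵥ y : ℝ) : ℂ)) * h y := by
  have hmp := PiLp.volume_preserving_ofLp (Fin n)
  have hmap1 : (volume : Measure (EuclideanSpace ℝ (Fin n))).map
      (MeasurableEquiv.toLp 2 (Fin n → ℝ)).symm = ENNReal.ofReal 1 • volume := by
    rw [ENNReal.ofReal_one, one_smul]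
    exact hmp.map_eq
  have hpi : (2 * Real.pi)⁻¹ ≠ 0 := by positivity
  let e2 : (Fin n → ℝ) ≃ᵐ EuclideanSpace ℝ (Fin n) :=
    (MeasurableEquiv.smul₀ (2 * Real.pi)⁻¹ hpi).trans (MeasurableEquiv.toLp 2 (Fin n → ℝ))
  have hmap2 : (volume : Measure (Fin n → ℝ)).map e2 =
      ENNReal.ofReal ((2 * Real.pi) ^ n) • volume := by
    have h1 := Measure.map_addHaar_smul (volume : Measure (Fin n → ℝ)) hpi
    have h2 := (PiLp.volume_preserving_toLp (Fin n)).map_eq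
    change Measure.map ((MeasurableEquiv.toLp 2 (Fin n → ℝ)) ∘ ((2 * Real.pi)⁻¹ • ·)) _ = _
    rw [← Measure.map_map (MeasurableEquiv.measurable _) (measurable_const_smul _), h1,
      Measure.map_smul]
    have h3 : Measure.map (MeasurableEquiv.toLp 2 (Fin n → ℝ)) volume = volume := h2
    rw [h3, Module.finrank_fin_fun, inv_pow, inv_inv, abs_of_pos (by positivity)]
  obtain ⟨U1, hU1⟩ := exists_unitary_comp _ one_pos hmap1
  obtain ⟨U2, hU2⟩ := exists_unitary_comp e2 (by positivity) hmap2
  refine ⟨(U1.trans (Lp.fourierTransformₗᵢ _ ℂ)).trans U2, fun h h1 h2 => ?_⟩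
  have hq1 := quasiMeasurePreserving_of_map_eq_smul _ hmap1
  have hq2 := quasiMeasurePreserving_of_map_eq_smul _ hmap2
  let k : EuclideanSpace ℝ (Fin n) → ℂ := fun y => h y.ofLp
  have hk1 : Integrable k := hmp.integrable_comp_of_integrable h1
  have hk2 : MemLp k 2 := h2.comp_measurePreserving hmp
  have hU : U1 h2.toLp = hk2.toLp := by
    apply Lp.ext
    filter_upwards [hU1 h2.toLp, hk2.coeFn_toLp, hq1.ae h2.coeFn_toLp] with x e1 e2 e3
    rw [e1, e2, e3]
    simp [k]
  simp only [LinearIsometryEquiv.trans_apply, hU]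
  filter_upwards [hU2 (Lp.fourierTransformₗᵢ _ ℂ hk2.toLp),
    hq2.ae (fourier_toLp_two_ae_eq hk1 hk2)] with ξ e1 e3
  rw [e1, e3, Real.fourier_eq']
  congr 1
  rw [← hmp.integral_comp (MeasurableEquiv.toLp 2 (Fin n → ℝ)).symm.measurableEmbedding]
  refine integral_congr_ae (.of_forall fun y => ?_)
  have hin : inner ℝ y (e2 ξ) = (2 * Real.pi)⁻¹ * (ξ ⬝ᵥ y.ofLp) := by
    rw [EuclideanSpace.inner_eq_star_dotProduct]
    change ((2 * Real.pi)⁻¹ • ξ) ⬝ᵥ star y.ofLp = _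
    rw [smul_dotProduct, smul_eq_mul, star_trivial]
  simp only [k, smul_eq_mul]
  rw [hin]
  congr 2
  rw [show -2 * Real.pi * ((2 * Real.pi)⁻¹ * (ξ ⬝ᵥ y.ofLp)) = -(ξ ⬝ᵥ y.ofLp) by
    field_simp]
  push_cast
  ring

theorem exists_measurableEquiv_splitVec (n : ℕ) :
    ∃ s : (Fin (2 * n) → ℝ) ≃ᵐ (Fin n → ℝ) × (Fin n → ℝ),
      (∀ z, s z = splitVec n z) ∧ MeasurePreserving s := by
  let σ : Fin n ⊕ Fin n ≃ Fin (2 * n) := finSumFinEquiv.trans (finCongr (by omega))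
  refine ⟨(MeasurableEquiv.piCongrLeft (fun _ => ℝ) σ).symm.trans
    (MeasurableEquiv.sumPiEquivProdPi fun _ => ℝ), fun z => ?_, ?_⟩
  · rfl
  · exact (volume_measurePreserving_sumPiEquivProdPi _).comp
      (volume_measurePreserving_piCongrLeft (fun _ => ℝ) σ).symm

theorem exists_measurableEquiv_splitVec_mulVec (n : ℕ)
    (f : Matrix (Fin (2 * n)) (Fin (2 * n)) ℝ) (hf : IsUnit f.det) :
    ∃ e : (Fin (2 * n) → ℝ) ≃ᵐ (Fin n → ℝ) × (Fin n → ℝ),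
      (∀ z, e z = splitVec n (f⁻¹ *ᵥ z)) ∧
      (volume : Measure (Fin (2 * n) → ℝ)).map e = ENNReal.ofReal |f.det| • volume := by
  obtain ⟨s, hs, hsp⟩ := exists_measurableEquiv_splitVec n
  have hf' : (f⁻¹).det ≠ 0 := by
    rw [det_nonsing_inv]
    simpa using hf.ne_zero
  let m : (Fin (2 * n) → ℝ) ≃ᵐ (Fin (2 * n) → ℝ) :=
    (toLin'OfInv (mul_nonsing_inv f hf)
      (nonsing_inv_mul f hf)).toContinuousLinearEquiv.toHomeomorph.toMeasurableEquiv
  have hm : ∀ z, m z = f⁻¹ *ᵥ z := fun z => rfl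
  refine ⟨m.trans s, fun z => ?_, ?_⟩
  · rw [MeasurableEquiv.trans_apply, hs, hm]
  · have h := Real.map_matrix_volume_pi_eq_smul_volume_pi hf'
    have hm' : ⇑m = ⇑(toLin' f⁻¹) := by
      ext1 z
      rw [hm, toLin'_apply]
    rw [MeasurableEquiv.coe_trans, ← Measure.map_map s.measurable m.measurable, hm', h,
      Measure.map_smul, hsp.map_eq, det_nonsing_inv, Ring.inverse_eq_inv', inv_inv]

/-- The measure-preserving change of variables `(x, y) ↦ (x + y / 2, x - y / 2)`. -/
theorem exists_measurableEquiv_midpoint (n : ℕ) :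
    ∃ e : (Fin n → ℝ) × (Fin n → ℝ) ≃ᵐ (Fin n → ℝ) × (Fin n → ℝ),
      (∀ p, e p = (p.1 + (1 / 2 : ℝ) • p.2, p.1 - (1 / 2 : ℝ) • p.2)) ∧ MeasurePreserving e := by
  let e : (Fin n → ℝ) × (Fin n → ℝ) ≃ᵐ (Fin n → ℝ) × (Fin n → ℝ) :=
    { toFun := fun p => (p.1 + (1 / 2 : ℝ) • p.2, p.1 - (1 / 2 : ℝ) • p.2)
      invFun := fun p => ((1 / 2 : ℝ) • (p.1 + p.2), p.1 - p.2)
      left_inv := fun p => by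
        ext i <;> simp <;> ring
      right_inv := fun p => by
        ext i <;> simp <;> ring
      measurable_toFun := by
        simp only [Equiv.coe_fn_mk]
        fun_prop
      measurable_invFun := by
        simp only [Equiv.coe_fn_symm_mk]
        fun_prop }
  refine ⟨e, fun p => rfl, ?_⟩
  have h1 : MeasurePreserving
      (fun p : (Fin n → ℝ) × (Fin n → ℝ) => (p.1, p.2 + (1 / 2 : ℝ) • p.1)) := by
    refine (MeasurePreserving.id volume).skew_product
      (g := fun y x : Fin n → ℝ => x + (1 / 2 : ℝ) • y) (by fun_prop) (.of_forall fun y => ?_)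
    exact (measurePreserving_add_right volume _).map_eq
  have h2 : MeasurePreserving
      (fun p : (Fin n → ℝ) × (Fin n → ℝ) => (p.1, p.1 - p.2)) := by
    refine (MeasurePreserving.id volume).skew_product
      (g := fun s y : Fin n → ℝ => s - y) (by fun_prop) (.of_forall fun s => ?_)
    exact (Measure.measurePreserving_sub_left volume s).map_eq
  have hswap : MeasurePreserving
      (Prod.swap : (Fin n → ℝ) × (Fin n → ℝ) → (Fin n → ℝ) × (Fin n → ℝ)) :=
    Measure.measurePreserving_swap
  have h3 := h2.comp (hswap.comp (h1.comp hswap))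
  convert! h3 using 1
  ext p i
  · rfl
  · simp [e]
    ring

theorem memLp_two_comp_add_smul {n : ℕ} (u : Lp ℂ 2 (volume : Measure (Fin n → ℝ)))
    (x : Fin n → ℝ) {r : ℝ} (hr : r ≠ 0) : MemLp (fun y => u (x + r • y)) 2 := by
  have hm : AEStronglyMeasurable (fun y => u (x + r • y)) :=
    ((Lp.stronglyMeasurable u).comp_measurable (by fun_prop)).aestronglyMeasurable
  rw [memLp_two_iff_integrable_sq_norm hm]
  have h := (memLp_two_iff_integrable_sq_norm (Lp.aestronglyMeasurable u)).1 (Lp.memLp u)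
  exact (h.comp_add_left x).comp_smul hr

theorem integrable_wigner_slice {n : ℕ} (u v : Lp ℂ 2 (volume : Measure (Fin n → ℝ)))
    (x : Fin n → ℝ) :
    Integrable fun y => u (x + (1 / 2 : ℝ) • y) * conj (v (x - (1 / 2 : ℝ) • y)) := by
  have hu := memLp_two_comp_add_smul u x (r := 1 / 2) (by norm_num)
  have hv := (memLp_two_comp_add_smul v x (r := -(1 / 2)) (by norm_num)).star
  have h := hu.integrable_mul hv
  simpa [sub_eq_add_neg] using! h

theorem stronglyMeasurable_crossWigner {n : ℕ} {u v : (Fin n → ℝ) → ℂ}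
    (hu : StronglyMeasurable u) (hv : StronglyMeasurable v) :
    StronglyMeasurable (crossWigner u v) := by
  refine StronglyMeasurable.const_mul ?_ _
  refine StronglyMeasurable.integral_prod_right'
    (f := fun q : ((Fin n → ℝ) × (Fin n → ℝ)) × (Fin n → ℝ) =>
      Complex.exp (-Complex.I * ((q.1.2 ⬝ᵥ q.2 : ℝ) : ℂ)) *
      u (q.1.1 + (1/2 : ℝ) • q.2) * conj (v (q.1.1 - (1/2 : ℝ) • q.2))) ?_
  have hu' := hu.measurable
  have hv' := hv.measurable
  have hconj : Measurable (conj : ℂ → ℂ) := Complex.continuous_conj.measurable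
  have hexp : Continuous fun q : ((Fin n → ℝ) × (Fin n → ℝ)) × (Fin n → ℝ) =>
      Complex.exp (-Complex.I * ((q.1.2 ⬝ᵥ q.2 : ℝ) : ℂ)) := by
    fun_prop
  refine ((hexp.measurable.mul (hu'.comp (by fun_prop))).mul
    (hconj.comp (hv'.comp (by fun_prop)))).stronglyMeasurable

/-- Suitably normalised, the cross-Wigner transform is the restriction of a unitary operator
to elementary tensors. -/
theorem exists_unitary_crossWigner (n : ℕ)
    (b : HilbertBasis ℕ ℂ (Lp ℂ 2 (volume : Measure (Fin n → ℝ)))) :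
    ∃ T : Lp ℂ 2 ((volume : Measure (Fin n → ℝ)).prod (volume : Measure (Fin n → ℝ))) ≃ₗᵢ[ℂ]
        Lp ℂ 2 (volume : Measure ((Fin n → ℝ) × (Fin n → ℝ))),
      ∀ u v : Lp ℂ 2 (volume : Measure (Fin n → ℝ)),
        T (tensorLp u (star v)) =ᵐ[volume]
          fun p => ((√((2 * Real.pi) ^ n) : ℝ) : ℂ) * crossWigner u v p := by
  obtain ⟨e, he, hep⟩ := exists_measurableEquiv_midpoint n
  have hmap : (volume : Measure ((Fin n → ℝ) × (Fin n → ℝ))).map e =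
      ENNReal.ofReal 1 • volume := by
    rw [ENNReal.ofReal_one, one_smul, hep.map_eq]
  obtain ⟨U, hU⟩ := exists_unitary_comp e one_pos hmap
  obtain ⟨G, hG⟩ := exists_unitary_fourier n
  obtain ⟨T, hT⟩ := exists_unitary_slicewise b b G
  refine ⟨U.trans T, fun u v => ?_⟩
  let h := U (tensorLp u (star v))
  have hq := hep.quasiMeasurePreserving
  have hh : h =ᵐ[volume.prod volume] fun p =>
      u (p.1 + (1 / 2 : ℝ) • p.2) * conj (v (p.1 - (1 / 2 : ℝ) • p.2)) := by
    have hstar : ∀ᵐ p : (Fin n → ℝ) × (Fin n → ℝ),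
        (star v : Lp ℂ 2 (volume : Measure (Fin n → ℝ))) p.2 = conj (v p.2) :=
      Measure.quasiMeasurePreserving_snd.ae (Lp.coeFn_star v)
    filter_upwards [hU (tensorLp u (star v)), hq.ae (coeFn_tensorLp u (star v)),
      hq.ae hstar] with p h1 h2 h3
    rw [h1, h2, h3, he]
    simp
  refine ae_prod_eq_of_slices (Lp.stronglyMeasurable (T h))
    ((stronglyMeasurable_crossWigner (Lp.stronglyMeasurable u)
      (Lp.stronglyMeasurable v)).const_mul _) ?_
  filter_upwards [hT h, memLp_two_slice (Lp.memLp h), Measure.ae_ae_of_ae_prod hh] with x h1 hx h3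
  have hk2 : MemLp (fun y => u (x + (1 / 2 : ℝ) • y) * conj (v (x - (1 / 2 : ℝ) • y))) 2 :=
    hx.ae_eq h3
  have hxk : hx.toLp = hk2.toLp := MemLp.toLp_congr hx hk2 h3
  have h4 := h1 hx
  rw [hxk] at h4
  filter_upwards [h4, hG _ (integrable_wigner_slice u v x) hk2] with ξ h5 h6
  rw [LinearIsometryEquiv.trans_apply, h5, h6, crossWigner, ← mul_assoc]
  congr 1
  · rw [← Complex.ofReal_mul, ← div_eq_mul_inv, Real.sqrt_div_self', one_div]
  · simp only [mul_assoc]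

/-- if `(φ_j)` is a Hilbert basis of `L²(ℝ^n)` then the family
`Φ_{j,k}(z) = (2π)^{n/2}|det f|^{-1/2} W(φ_k,φ_j)(f⁻¹z)` is a Hilbert basis of
`L²(ℝ^{2n})`. -/
theorem stmt16 (n : ℕ) (hn : 1 ≤ n)
    (f : Matrix (Fin (2 * n)) (Fin (2 * n)) ℝ) (hf : IsUnit f.det)
    (b : HilbertBasis ℕ ℂ (Lp ℂ 2 (volume : Measure (Fin n → ℝ)))) :
    ∃ B : HilbertBasis (ℕ × ℕ) ℂ (Lp ℂ 2 (volume : Measure (Fin (2 * n) → ℝ))),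
      ∀ j k : ℕ,
        (B (j, k) : (Fin (2 * n) → ℝ) → ℂ)
          =ᵐ[volume] fun z =>
            ((Real.sqrt ((2 * Real.pi) ^ n) : ℝ) : ℂ) *
              (((Real.sqrt |f.det|)⁻¹ : ℝ) : ℂ) *
              crossWigner (fun w => (b k : (Fin n → ℝ) → ℂ) w)
                (fun w => (b j : (Fin n → ℝ) → ℂ) w) (splitVec n (f⁻¹ *ᵥ z)) := by
  obtain ⟨c, hc⟩ := exists_conj_hilbertBasis b
  obtain ⟨B, hB⟩ := exists_tensor_hilbertBasis b c
  obtain ⟨T, hT⟩ := exists_unitary_crossWigner n b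
  obtain ⟨e, he, hmap⟩ := exists_measurableEquiv_splitVec_mulVec n f hf
  obtain ⟨U, hU⟩ := exists_unitary_comp e (abs_pos.2 hf.ne_zero) hmap
  refine ⟨B.mapUnitary (T.trans U), fun j k => ?_⟩
  rw [HilbertBasis.mapUnitary_apply, LinearIsometryEquiv.trans_apply, hB, hc]
  filter_upwards [hU (T (tensorLp (b k) (star (b j)))),
    (quasiMeasurePreserving_of_map_eq_smul e hmap).ae (hT (b k) (b j))] with z h1 h2
  rw [h1, h2, he]
  ring
end
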